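/- arXiv:1602.03786 — 6 statements merged into one kernel-verified Lean document; each statement's English description precedes it below -/
import Mathlib

section
/- Let t_0 ∈ ℝ, 0 < v_0 < v_max, u_max > 0 and L > 0 with v_max² − v_0² ≤ 2·L·u_max. Define t_s = t_0 + (v_max − v_0)/u_max and the position function p(t) = v_0·(t − t_0) + (1/2)·u_max·(t − t_0)² for t_0 ≤ t ≤ t_s, and p(t) = p(t_s) + v_max·(t − t_s) for t ≥ t_s (maximal acceleration until reaching the speed limit, then cruising). Then p(t¹) = L, where t¹ = t_0 + L/v_max + (v_max − v_0)²/(2·u_max·v_max), and t¹ ≥ t_s. -/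
/-- Accelerate at `umax` until reaching the speed limit `vmax` at time `ts`,
then cruise at `vmax`: the resulting trajectory reaches position `L` exactly at
`t¹ = t₀ + L/vmax + (vmax − v₀)²/(2·umax·vmax)`, and `t¹ ≥ ts`. -/
theorem stmt_5 (t0 v0 vmax umax L : ℝ) (hv0 : 0 < v0) (hv : v0 < vmax)
    (hu : 0 < umax) (hL : 0 < L) (hreach : vmax ^ 2 - v0 ^ 2 ≤ 2 * L * umax)
    (ts : ℝ) (hts : ts = t0 + (vmax - v0) / umax)
    (p : ℝ → ℝ)
    (hp1 : ∀ t, t0 ≤ t → t ≤ ts →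
      p t = v0 * (t - t0) + (1 / 2) * umax * (t - t0) ^ 2)
    (hp2 : ∀ t, ts ≤ t → p t = p ts + vmax * (t - ts))
    (t1 : ℝ) (ht1 : t1 = t0 + L / vmax + (vmax - v0) ^ 2 / (2 * umax * vmax)) :
    p t1 = L ∧ ts ≤ t1 := by
  have hvmax : 0 < vmax := hv0.trans hv
  have hdiff : t1 - ts = (2 * L * umax - (vmax ^ 2 - v0 ^ 2)) / (2 * umax * vmax) := by
    rw [ht1, hts]
    field_simp
    ring
  have hts_le : ts ≤ t1 := by
    rw [← sub_nonneg, hdiff]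
    exact div_nonneg (sub_nonneg.2 hreach) (by positivity)
  have ht0_le : t0 ≤ ts := by
    rw [hts]
    exact le_add_of_nonneg_right (div_nonneg (sub_nonneg.2 hv.le) hu.le)
  refine ⟨?_, hts_le⟩
  have hramp : ts - t0 = (vmax - v0) / umax := by rw [hts, add_sub_cancel_left]
  rw [hp2 t1 hts_le, hp1 ts ht0_le le_rfl, hdiff, hramp]
  field_simp
  ring
end

section
/- Let t_0 < t_m, u_max > 0, L > 0, and let v : ℝ → ℝ be differentiable on [t_0, t_m] with v(t_0) = v_0 ≥ 0, derivative v'(t) ≤ u_max for all t ∈ [t_0, t_m], and ∫_{t_0}^{t_m} v(t) dt = L. Then t_m ≥ t_0 + (√(2·L·u_max + v_0²) − v_0)/u_max. (No vehicle respecting the acceleration limit can reach the merging zone earlier than the maximal-acceleration trajectory; this is the lower bound t_i^2 used in Theorem 1.) -/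
/-- Lower bound `t_i^2` of Theorem 1: no vehicle respecting the acceleration
limit `v' ≤ umax` can traverse the control zone of length `L` faster than the
maximal-acceleration trajectory. -/
theorem stmt_7 (t0 tm umax L v0 : ℝ) (v v' : ℝ → ℝ)
    (ht : t0 < tm) (hu : 0 < umax) (hL : 0 < L) (hv0' : 0 ≤ v0)
    (hv0 : v t0 = v0)
    (hderiv : ∀ t ∈ Set.Icc t0 tm, HasDerivAt v (v' t) t)
    (hubound : ∀ t ∈ Set.Icc t0 tm, v' t ≤ umax)
    (hint : ∫ t in t0..tm, v t = L) :
    t0 + (Real.sqrt (2 * L * umax + v0 ^ 2) - v0) / umax ≤ tm := by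
  have hcont : ContinuousOn v (Set.Icc t0 tm) := fun t h =>
    (hderiv t h).continuousAt.continuousWithinAt
  have hspeed : ∀ t ∈ Set.Icc t0 tm, v t ≤ v0 + umax * (t - t0) := by
    intro t h
    have hmvt := (convex_Icc t0 tm).image_sub_le_mul_sub_of_deriv_le hcont
      (fun s hs => (hderiv s (interior_subset hs)).differentiableAt.differentiableWithinAt)
      (fun s hs => (hderiv s (interior_subset hs)).deriv.trans_le
        (hubound s (interior_subset hs)))
      t0 (Set.left_mem_Icc.2 ht.le) t h h.1
    linarith
  have hmax : ∫ t in t0..tm, (v0 + umax * (t - t0)) =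
      v0 * (tm - t0) + umax * (tm - t0) ^ 2 / 2 := by
    rw [intervalIntegral.integral_eq_sub_of_hasDerivAt
      (f := fun t => v0 * (t - t0) + umax * (t - t0) ^ 2 / 2)]
    · ring
    · intro t _
      have hd := (hasDerivAt_id t).sub_const t0
      refine ((hd.const_mul v0).add
        (((hd.pow 2).const_mul umax).div_const 2)).congr_deriv ?_
      simp only [id, Nat.cast_ofNat, Nat.add_one_sub_one]
      ring
    · exact Continuous.intervalIntegrable (by fun_prop) _ _
  have hdist : L ≤ v0 * (tm - t0) + umax * (tm - t0) ^ 2 / 2 := by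
    rw [← hint, ← hmax]
    exact intervalIntegral.integral_mono_on ht.le (hcont.intervalIntegrable_of_Icc ht.le)
      (Continuous.intervalIntegrable (by fun_prop) _ _) hspeed
  have hT : 0 < tm - t0 := sub_pos.2 ht
  have hsqrt : Real.sqrt (2 * L * umax + v0 ^ 2) ≤ v0 + umax * (tm - t0) :=
    Real.sqrt_le_iff.2 ⟨by positivity, by nlinarith⟩
  have hdiv : (Real.sqrt (2 * L * umax + v0 ^ 2) - v0) / umax ≤ tm - t0 := by
    rw [div_le_iff₀ hu]
    linarith
  linarith
end

section
/- Let t_0 < t_m, u_max > 0, L > 0, 0 ≤ v_0 ≤ v_max with v_max > 0 and v_max² − v_0² ≤ 2·L·u_max, and let v : ℝ → ℝ be differentiable on [t_0, t_m] with v(t_0) = v_0, v'(t) ≤ u_max and v(t) ≤ v_max for all t ∈ [t_0, t_m], and ∫_{t_0}^{t_m} v(t) dt = L. Then t_m ≥ t_0 + L/v_max + (v_max − v_0)²/(2·u_max·v_max). (No vehicle respecting both the acceleration and speed limits can reach the merging zone earlier than the accelerate-then-cruise trajectory; this is the lower bound t_i^1 used in Theorem 1.) -/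
/-- A velocity whose derivative is at most `u` grows at most linearly with slope `u`. -/
theorem le_add_mul_of_hasDerivAt_le {a b u : ℝ} {v v' : ℝ → ℝ}
    (hderiv : ∀ t ∈ Set.Icc a b, HasDerivAt v (v' t) t)
    (hubound : ∀ t ∈ Set.Icc a b, v' t ≤ u) {t : ℝ} (ht : t ∈ Set.Icc a b) :
    v t ≤ v a + u * (t - a) := by
  have h := (convex_Icc a b).image_sub_le_mul_sub_of_deriv_le (f := v) (C := u)
    (fun x hx => (hderiv x hx).continuousAt.continuousWithinAt)
    (fun x hx => (hderiv x (interior_subset hx)).differentiableAt.differentiableWithinAt)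
    (fun x hx => by
      rw [(hderiv x (interior_subset hx)).deriv]
      exact hubound x (interior_subset hx))
    a (Set.left_mem_Icc.2 (ht.1.trans ht.2)) t ht ht.1
  linarith

/-- The distance covered under the acceleration limit `u` is at most that of the motion with
constant acceleration `u`. -/
theorem integral_le_of_hasDerivAt_le {a b u : ℝ} {v v' : ℝ → ℝ} (hab : a ≤ b)
    (hderiv : ∀ t ∈ Set.Icc a b, HasDerivAt v (v' t) t)
    (hubound : ∀ t ∈ Set.Icc a b, v' t ≤ u) :
    ∫ t in a..b, v t ≤ v a * (b - a) + u * (b - a) ^ 2 / 2 := by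
  have hcont : ContinuousOn v (Set.Icc a b) :=
    fun x hx => (hderiv x hx).continuousAt.continuousWithinAt
  have hprim : ∫ t in a..b, (v a + u * (t - a)) = v a * (b - a) + u * (b - a) ^ 2 / 2 := by
    rw [intervalIntegral.integral_eq_sub_of_hasDerivAt
      (f := fun t => v a * (t - a) + u * (t - a) ^ 2 / 2)]
    · ring
    · intro x _
      have h1 := (hasDerivAt_id x).sub_const a
      convert (h1.const_mul (v a)).add (((h1.pow 2).const_mul u).div_const 2) using 1
      · rfl
      · simp
        ring
    · exact Continuous.intervalIntegrable (by fun_prop) _ _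
  rw [← hprim]
  exact intervalIntegral.integral_mono_on hab (hcont.intervalIntegrable_of_Icc hab)
    (Continuous.intervalIntegrable (by fun_prop) _ _)
    fun t ht => le_add_mul_of_hasDerivAt_le hderiv hubound ht


/-- Lower bound `t_i^1` of Theorem 1: no vehicle respecting both the
acceleration limit `v' ≤ umax` and the speed limit `v ≤ vmax` can traverse the
control zone of length `L` faster than the accelerate-then-cruise trajectory. -/
theorem stmt_8 (t0 tm umax L v0 vmax : ℝ) (v v' : ℝ → ℝ)
    (ht : t0 < tm) (hu : 0 < umax) (hL : 0 < L)
    (hv0nonneg : 0 ≤ v0) (hv0le : v0 ≤ vmax) (hvmax : 0 < vmax)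
    (hreach : vmax ^ 2 - v0 ^ 2 ≤ 2 * L * umax)
    (hv0 : v t0 = v0)
    (hderiv : ∀ t ∈ Set.Icc t0 tm, HasDerivAt v (v' t) t)
    (hubound : ∀ t ∈ Set.Icc t0 tm, v' t ≤ umax)
    (hvbound : ∀ t ∈ Set.Icc t0 tm, v t ≤ vmax)
    (hint : ∫ t in t0..tm, v t = L) :
    t0 + L / vmax + (vmax - v0) ^ 2 / (2 * umax * vmax) ≤ tm := by
  obtain ⟨d, rfl⟩ : ∃ d, vmax = v0 + umax * d := ⟨(vmax - v0) / umax, by field_simp; ring⟩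
  have hd : 0 ≤ d := by
    by_contra! h
    nlinarith
  suffices h : L + umax * d ^ 2 / 2 ≤ (v0 + umax * d) * (tm - t0) by
    have heq : L / (v0 + umax * d) + (v0 + umax * d - v0) ^ 2 / (2 * umax * (v0 + umax * d))
        = (L + umax * d ^ 2 / 2) / (v0 + umax * d) := by
      field_simp
      ring
    have hle := (div_le_iff₀ hvmax).2 (h.trans_eq (mul_comm _ _))
    linarith
  rcases lt_or_ge tm (t0 + d) with hlt | hge
  · have h := integral_le_of_hasDerivAt_le ht.le hderiv hubound
    rw [hint, hv0] at h
    have hL' : v0 * d + umax * d ^ 2 / 2 ≤ L := by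
      refine le_of_mul_le_mul_left ?_ (mul_pos two_pos hu)
      linarith
    have h1 : v0 * (tm - t0) ≤ v0 * d := by gcongr; linarith
    have h2 : umax * (tm - t0) ^ 2 < umax * d ^ 2 := by
      have : 0 ≤ tm - t0 := by linarith
      gcongr
      linarith
    linarith
  · have hsub : Set.Icc t0 (t0 + d) ⊆ Set.Icc t0 tm := Set.Icc_subset_Icc_right hge
    have hsub' : Set.Icc (t0 + d) tm ⊆ Set.Icc t0 tm := Set.Icc_subset_Icc_left (by linarith)
    have hcont : ContinuousOn v (Set.Icc t0 tm) :=
      fun x hx => (hderiv x hx).continuousAt.continuousWithinAt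
    have hi1 := (hcont.mono hsub).intervalIntegrable_of_Icc (μ := MeasureTheory.volume)
      (by linarith)
    have hi2 := (hcont.mono hsub').intervalIntegrable_of_Icc (μ := MeasureTheory.volume) hge
    have hacc := integral_le_of_hasDerivAt_le (by linarith)
      (fun t h => hderiv t (hsub h)) (fun t h => hubound t (hsub h))
    have hcruise : ∫ t in (t0 + d)..tm, v t ≤ ∫ _ in (t0 + d)..tm, (v0 + umax * d) :=
      intervalIntegral.integral_mono_on hge hi2 intervalIntegrable_const
        fun t h => hvbound t (hsub' h)
    rw [intervalIntegral.integral_const, smul_eq_mul] at hcruise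
    rw [hv0] at hacc
    have hsum := intervalIntegral.integral_add_adjacent_intervals hi1 hi2
    rw [hint] at hsum
    linarith
end

section
/- Let t_0 < t_m and a, b, c, d, v_0, L ∈ ℝ be such that the cubic p*(t) = (1/6)·a·t³ + (1/2)·b·t² + c·t + d satisfies p*(t_0) = 0, (p*)'(t_0) = v_0, p*(t_m) = L, and a·t_m + b = 0. Then for every twice continuously differentiable x : ℝ → ℝ with x(t_0) = 0, x'(t_0) = v_0 and x(t_m) = L, one has ∫_{t_0}^{t_m} (x''(t))² dt ≥ ∫_{t_0}^{t_m} (a·t + b)² dt. (The linear-in-time control u*(t) = a·t + b minimizes the L²-energy ½∫u² among all trajectories with the given initial position, initial speed and terminal position, when the terminal speed is free and the transversality condition u*(t_m) = 0 holds.) -/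
/-- Optimality of the linear-in-time control `u*(t) = a·t + b` with
transversality condition `a·t_m + b = 0`: among all twice continuously
differentiable trajectories with the given initial position, initial speed and
terminal position (terminal speed free), the cubic `p*` minimizes the
`L²`-energy of the acceleration. -/
theorem stmt_10 (t0 tm a b c d v0 L : ℝ) (ht : t0 < tm)
    (pstar : ℝ → ℝ)
    (hpstar : pstar = fun t => (1 / 6) * a * t ^ 3 + (1 / 2) * b * t ^ 2 + c * t + d)
    (hp0 : pstar t0 = 0) (hv0 : deriv pstar t0 = v0) (hpm : pstar tm = L)
    (htrans : a * tm + b = 0)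
    (x : ℝ → ℝ) (hx : ContDiff ℝ 2 x)
    (hx0 : x t0 = 0) (hx0' : deriv x t0 = v0) (hxm : x tm = L) :
    ∫ t in t0..tm, (a * t + b) ^ 2 ≤ ∫ t in t0..tm, (deriv (deriv x) t) ^ 2 := by
  have hp (t : ℝ) : HasDerivAt pstar (1 / 2 * a * t ^ 2 + b * t + c) t := by
    rw [hpstar]
    have h := (((((hasDerivAt_id t).pow 3).const_mul (1 / 6 * a)).add
      (((hasDerivAt_id t).pow 2).const_mul (1 / 2 * b))).add
      ((hasDerivAt_id t).const_mul c)).add_const d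
    refine h.congr_deriv ?_
    simp only [id]
    push_cast
    ring
  have hq (t : ℝ) : HasDerivAt (fun t => 1 / 2 * a * t ^ 2 + b * t + c) (a * t + b) t := by
    have h := ((((hasDerivAt_id t).pow 2).const_mul (1 / 2 * a)).add
      ((hasDerivAt_id t).const_mul b)).add_const c
    refine h.congr_deriv ?_
    simp only [id]
    push_cast
    ring
  have hu (t : ℝ) : HasDerivAt (fun t => a * t + b) a t := by
    simpa using ((hasDerivAt_id t).const_mul a).add_const b
  have hdx : ContDiff ℝ 1 (deriv x) := (contDiff_succ_iff_deriv (n := 1).1 hx).2.2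
  have hx1 (t : ℝ) : HasDerivAt x (deriv x t) t :=
    (hx.differentiable (by norm_num) t).hasDerivAt
  have hx2 (t : ℝ) : HasDerivAt (deriv x) (deriv (deriv x) t) t :=
    (hdx.differentiable (by norm_num) t).hasDerivAt
  have hcont : Continuous (deriv (deriv x)) := hdx.continuous_deriv le_rfl
  have orth : ∫ t in t0..tm, (a * t + b) * (deriv (deriv x) t - (a * t + b)) = 0 := by
    rw [intervalIntegral.integral_eq_sub_of_hasDerivAt
      (f := fun t => (a * t + b) * (deriv x t - (1 / 2 * a * t ^ 2 + b * t + c))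
        - a * (x t - pstar t))]
    · have h0 : deriv x t0 = 1 / 2 * a * t0 ^ 2 + b * t0 + c := by
        rw [hx0', ← hv0, (hp t0).deriv]
      simp [htrans, hxm, hpm, hx0, hp0, h0]
    · intro t _
      refine (((hu t).mul ((hx2 t).sub (hq t))).sub
        (((hx1 t).sub (hp t)).const_mul a)).congr_deriv ?_
      simp only [Pi.sub_apply]
      ring
    · exact Continuous.intervalIntegrable (by fun_prop) _ _
  calc ∫ t in t0..tm, (a * t + b) ^ 2
      = ∫ t in t0..tm, ((a * t + b) ^ 2
          + 2 * ((a * t + b) * (deriv (deriv x) t - (a * t + b)))) := by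
        rw [intervalIntegral.integral_add (Continuous.intervalIntegrable (by fun_prop) _ _)
          (Continuous.intervalIntegrable (by fun_prop) _ _),
          intervalIntegral.integral_const_mul, orth, mul_zero, add_zero]
    _ ≤ ∫ t in t0..tm, (deriv (deriv x) t) ^ 2 := by
        refine intervalIntegral.integral_mono_on ht.le
          (Continuous.intervalIntegrable (by fun_prop) _ _)
          (Continuous.intervalIntegrable (by fun_prop) _ _) fun t _ => ?_
        nlinarith [sq_nonneg (deriv (deriv x) t - (a * t + b))]
end

section
/- Let t_0 < t_m and a, b, c, d, v_0, L ∈ ℝ be such that p*(t) = (1/6)·a·t³ + (1/2)·b·t² + c·t + d satisfies p*(t_0) = 0, (p*)'(t_0) = v_0, p*(t_m) = L and a·t_m + b = 0. Then for every twice continuously differentiable x : ℝ → ℝ with x(t_0) = 0, x'(t_0) = v_0 and x(t_m) = L, the cross term vanishes: ∫_{t_0}^{t_m} (a·t + b)·(x''(t) − (a·t + b)) dt = 0. -/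
/-- Orthogonality (vanishing cross term) in the optimality proof of the linear
control `u*(t) = a·t + b` with `u*(t_m) = 0`: for every admissible trajectory
`x`, `∫ (a·t+b)·(x''(t) − (a·t+b)) dt = 0`. -/
theorem stmt_11 (t0 tm a b c d v0 L : ℝ) (ht : t0 < tm)
    (pstar : ℝ → ℝ)
    (hpstar : pstar = fun t => (1 / 6) * a * t ^ 3 + (1 / 2) * b * t ^ 2 + c * t + d)
    (hp0 : pstar t0 = 0) (hv0 : deriv pstar t0 = v0) (hpm : pstar tm = L)
    (htrans : a * tm + b = 0)
    (x : ℝ → ℝ) (hx : ContDiff ℝ 2 x)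
    (hx0 : x t0 = 0) (hx0' : deriv x t0 = v0) (hxm : x tm = L) :
    ∫ t in t0..tm, (a * t + b) * (deriv (deriv x) t - (a * t + b)) = 0 := by
  subst hpstar
  have hp (t : ℝ) : HasDerivAt
      (fun t => (1 / 6) * a * t ^ 3 + (1 / 2) * b * t ^ 2 + c * t + d)
      ((1 / 2) * a * t ^ 2 + b * t + c) t := by
    refine (((((hasDerivAt_pow 3 t).const_mul ((1 / 6) * a)).add
      ((hasDerivAt_pow 2 t).const_mul ((1 / 2) * b))).add
      ((hasDerivAt_id t).const_mul c)).add_const d).congr_deriv ?_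
    norm_num
    ring
  have hp' (t : ℝ) : HasDerivAt (fun t => (1 / 2) * a * t ^ 2 + b * t + c) (a * t + b) t := by
    refine ((((hasDerivAt_pow 2 t).const_mul ((1 / 2) * a)).add
      ((hasDerivAt_id t).const_mul b)).add_const c).congr_deriv ?_
    norm_num
    ring
  have hu (t : ℝ) : HasDerivAt (fun t => a * t + b) a t := by
    simpa using ((hasDerivAt_id t).const_mul a).add_const b
  have hdx : ContDiff ℝ 1 (deriv x) := ContDiff.deriv' hx
  have hx1 (t : ℝ) : HasDerivAt x (deriv x t) t :=
    (hx.differentiable (by norm_num) t).hasDerivAt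
  have hx2 (t : ℝ) : HasDerivAt (deriv x) (deriv (deriv x) t) t :=
    (hdx.differentiable (by norm_num) t).hasDerivAt
  have hcont : Continuous (deriv (deriv x)) := hdx.continuous_deriv le_rfl
  have hF (t : ℝ) := ((hu t).mul ((hx2 t).sub (hp' t))).sub
    (((hx1 t).sub (hp t)).const_mul a)
  rw [intervalIntegral.integral_eq_sub_of_hasDerivAt
    (fun t _ => (hF t).congr_deriv (by simp only [Pi.sub_apply]; ring))
    (Continuous.intervalIntegrable (by fun_prop) _ _)]
  rw [(hp t0).deriv] at hv0
  simp only [Pi.sub_apply, Pi.mul_apply] at *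
  rw [htrans, hxm, hpm, hx0, hp0, hx0', hv0]
  ring
end

section
/- Suppose CAV i−1 travels immediately ahead of CAV i in the same lane and enters the merging zone at time t_{i-1}^m with speed v_{i-1}^m > 0, and let δ > 0, u_max > 0, L > 0. Let v : ℝ → ℝ be differentiable on [t_0, t_m] with t_0 < t_m, v(t_0) = v_0 ≥ 0, v'(t) ≤ u_max for all t ∈ [t_0, t_m], ∫_{t_0}^{t_m} v(t) dt = L, and suppose the rear-end safety constraint at the merging-zone entry holds: v_{i-1}^m·(t_m − t_{i-1}^m) ≥ δ. Then t_m ≥ max(t_{i-1}^m + δ/v_{i-1}^m, t_0 + (√(2·L·u_max + v_0²) − v_0)/u_max). (This is the lower bound of Theorem 1 in the case i−1 ∈ L_i, when the speed limit is not reached.) -/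
/-- A function whose derivative is at most `C` on `[a, b]` grows at most linearly with slope `C`. -/
theorem le_add_mul_sub_of_hasDerivAt_le {f f' : ℝ → ℝ} {a b C : ℝ}
    (hf : ∀ t ∈ Set.Icc a b, HasDerivAt f (f' t) t) (hC : ∀ t ∈ Set.Icc a b, f' t ≤ C)
    {t : ℝ} (ht : t ∈ Set.Icc a b) : f t ≤ f a + C * (t - a) := by
  have h := (convex_Icc a b).image_sub_le_mul_sub_of_deriv_le
    (fun x hx => (hf x hx).continuousAt.continuousWithinAt)
    (fun x hx => (hf x (interior_subset hx)).differentiableAt.differentiableWithinAt)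
    (fun x hx => (hf x (interior_subset hx)).deriv.trans_le (hC x (interior_subset hx)))
    a (Set.left_mem_Icc.2 (ht.1.trans ht.2)) t ht ht.1
  linarith

/-- The integral of an affine function written around the left endpoint. -/
theorem integral_const_add_mul_sub (a b c C : ℝ) :
    ∫ t in a..b, (c + C * (t - a)) = c * (b - a) + C * (b - a) ^ 2 / 2 := by
  have h : ∀ t ∈ Set.uIcc a b,
      HasDerivAt (fun t => c * (t - a) + C * (t - a) ^ 2 / 2) (c + C * (t - a)) t := by
    intro t _
    have h₁ : HasDerivAt (fun t => t - a) 1 t := (hasDerivAt_id t).sub_const a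
    refine ((h₁.const_mul c).add (((h₁.pow 2).const_mul C).div_const 2)).congr_deriv ?_
    push_cast
    ring
  rw [intervalIntegral.integral_eq_sub_of_hasDerivAt h
    (Continuous.intervalIntegrable (by fun_prop) _ _)]
  ring

/-- Lower bound of Theorem 1 in the case `i−1 ∈ L_i` (same lane, speed limit not
reached): the MZ entry time `t_m` is at least the maximum of the rear-end
safety bound `t_{i-1}^m + δ/v_{i-1}^m` and the maximal-acceleration bound
`t₀ + (√(2·L·umax + v₀²) − v₀)/umax`. -/
theorem stmt_13 (tim1 vim1 δ umax L t0 tm v0 : ℝ) (v v' : ℝ → ℝ)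
    (hvim1 : 0 < vim1) (hδ : 0 < δ) (hu : 0 < umax) (hL : 0 < L)
    (ht : t0 < tm) (hv0nonneg : 0 ≤ v0) (hv0 : v t0 = v0)
    (hderiv : ∀ t ∈ Set.Icc t0 tm, HasDerivAt v (v' t) t)
    (hubound : ∀ t ∈ Set.Icc t0 tm, v' t ≤ umax)
    (hint : ∫ t in t0..tm, v t = L)
    (hsafe : δ ≤ vim1 * (tm - tim1)) :
    max (tim1 + δ / vim1)
      (t0 + (Real.sqrt (2 * L * umax + v0 ^ 2) - v0) / umax) ≤ tm := by
  have hcont : ContinuousOn v (Set.Icc t0 tm) :=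
    fun t h => (hderiv t h).continuousAt.continuousWithinAt
  have hL_le : L ≤ v0 * (tm - t0) + umax * (tm - t0) ^ 2 / 2 := by
    rw [← hint, ← integral_const_add_mul_sub]
    refine intervalIntegral.integral_mono_on ht.le (hcont.intervalIntegrable_of_Icc ht.le)
      (Continuous.intervalIntegrable (by fun_prop) _ _) fun t h => ?_
    rw [← hv0]
    exact le_add_mul_sub_of_hasDerivAt_le hderiv hubound h
  have hsqrt : Real.sqrt (2 * L * umax + v0 ^ 2) ≤ v0 + umax * (tm - t0) := by
    refine Real.sqrt_le_iff.2 ⟨?_, ?_⟩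
    · have := mul_pos hu (sub_pos.2 ht)
      linarith
    · linarith [mul_le_mul_of_nonneg_left hL_le hu.le]
  refine max_le ?_ ?_
  · have : δ / vim1 ≤ tm - tim1 := (div_le_iff₀' hvim1).2 hsafe
    linarith
  · have : (Real.sqrt (2 * L * umax + v0 ^ 2) - v0) / umax ≤ tm - t0 :=
      (div_le_iff₀' hu).2 (by linarith)
    linarith
end
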